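/- arXiv:1108.0095 — 2 statements merged into one kernel-verified Lean document; each statement's English description precedes it below -/
import Mathlib

section
/- For every $\varepsilon > 0$ there is a constant $K(\varepsilon)$ such that for every integer $a \ge 1$, every non-principal Dirichlet character $\chi$ modulo $a$, and every $s = \sigma + it$ with $\frac{1}{2} \le \sigma \le 1$ and $|t| \ge 1$, one has $|L(s,\chi)| \le K(\varepsilon)\, (a|t|)^{\frac{1-\sigma}{2} + \varepsilon}$. -/
open Complex Filter Topology MeasureTheory Set

theorem exists_norm_mellin_le_of_mem_strip {f : ℝ → ℂ} (hf : ∀ s, MellinConvergent f s)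
    (a b : ℝ) : ∃ C, ∀ s : ℂ, a ≤ s.re → s.re ≤ b → ‖mellin f s‖ ≤ C := by
  refine ⟨∫ t : ℝ in Ioi 0, (‖(t : ℂ) ^ ((a : ℂ) - 1) • f t‖ + ‖(t : ℂ) ^ ((b : ℂ) - 1) • f t‖),
    fun s ha hb ↦ ?_⟩
  refine norm_integral_le_of_norm_le ((hf a).norm.add (hf b).norm) ?_
  filter_upwards [ae_restrict_mem measurableSet_Ioi] with t (ht : 0 < t)
  simp only [norm_smul, norm_cpow_eq_rpow_re_of_pos ht, sub_re, ofReal_re, one_re, ← add_mul]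
  gcongr
  rcases le_total 1 t with h | h
  · exact (Real.rpow_le_rpow_of_exponent_le h (by linarith)).trans
      (le_add_of_nonneg_left (by positivity))
  · exact (Real.rpow_le_rpow_of_exponent_ge ht h (by linarith)).trans
      (le_add_of_nonneg_right (by positivity))

theorem IsStrongFEPair.exists_norm_Λ_le {P : WeakFEPair ℂ} (hP : IsStrongFEPair P) (a b : ℝ) :
    ∃ C, ∀ s : ℂ, a ≤ s.re → s.re ≤ b → ‖P.Λ s‖ ≤ C := by
  rw [hP.Λ_eq]
  exact exists_norm_mellin_le_of_mem_strip (fun s ↦ (hP.hasMellin s).1) a b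

theorem WeakFEPair.exists_norm_Λ₀_le (P : WeakFEPair ℂ) (a b : ℝ) :
    ∃ C, ∀ s : ℂ, a ≤ s.re → s.re ≤ b → ‖P.Λ₀ s‖ ≤ C :=
  exists_norm_mellin_le_of_mem_strip (fun s ↦ (P.isStrongFEPair_toStrongFEPair.hasMellin s).1) a b

namespace DirichletCharacter

theorem exists_norm_completedLFunction_le {N : ℕ} [NeZero N] {χ : DirichletCharacter ℂ N}
    (hχ : χ ≠ 1) (a b : ℝ) :
    ∃ C, ∀ s : ℂ, a ≤ s.re → s.re ≤ b → ‖completedLFunction χ s‖ ≤ C := by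
  have h0 : χ 0 = 0 := χ.map_zero' fun h ↦ hχ (by subst h; exact level_one χ)
  have h1 : ∑ j, χ j = 0 := χ.sum_eq_zero_of_ne_one hχ
  choose A hA using fun j : ZMod N ↦
    (HurwitzZeta.hurwitzEvenFEPair (ZMod.toAddCircle j)).exists_norm_Λ₀_le (a / 2) (b / 2)
  choose B hB using fun j : ZMod N ↦
    (HurwitzZeta.isStrong_hurwitzOddFEPair (ZMod.toAddCircle j)).exists_norm_Λ_le
      ((a + 1) / 2) ((b + 1) / 2)
  have hN : (1 : ℝ) ≤ N := by exact_mod_cast NeZero.one_le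
  refine ⟨(N : ℝ) ^ (-a) * (∑ j : ZMod N, A j / 2) + (N : ℝ) ^ (-a) * (∑ j : ZMod N, B j / 2),
    fun s ha hb ↦ ?_⟩
  have hNs : ‖(N : ℂ) ^ (-s)‖ ≤ (N : ℝ) ^ (-a) := by
    rw [norm_natCast_cpow_of_pos (NeZero.pos N), neg_re]
    exact Real.rpow_le_rpow_of_exponent_le hN (by linarith)
  have key (g : ZMod N → ℂ) (G : ZMod N → ℝ) (hg : ∀ j, ‖g j‖ ≤ G j) :
      ‖(N : ℂ) ^ (-s) * ∑ j, χ j * g j‖ ≤ (N : ℝ) ^ (-a) * ∑ j, G j := by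
    rw [norm_mul]
    gcongr
    refine norm_sum_le_of_le _ fun j _ ↦ ?_
    rw [norm_mul]
    exact (mul_le_of_le_one_left (norm_nonneg _) (χ.norm_le_one j)).trans (hg j)
  rw [completedLFunction, ZMod.completedLFunction_eq, h0, h1]
  simp only [mul_zero, zero_div, sub_zero]
  refine norm_add_le_of_le (key _ _ fun j ↦ ?_) (key _ _ fun j ↦ ?_)
  · rw [HurwitzZeta.completedHurwitzZetaEven₀, norm_div, Complex.norm_ofNat]
    gcongr
    refine hA j _ ?_ ?_ <;> simp <;> linarith
  · rw [HurwitzZeta.completedHurwitzZetaOdd, norm_div, Complex.norm_ofNat]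
    gcongr
    refine hB j _ ?_ ?_ <;> simp <;> linarith

theorem IsPrimitive.norm_gaussSum_sq {N : ℕ} [NeZero N] {χ : DirichletCharacter ℂ N}
    (hχ : χ.IsPrimitive) : ‖gaussSum χ ZMod.stdAddChar‖ ^ 2 = N := by
  have h : gaussSum χ ZMod.stdAddChar * star (gaussSum χ ZMod.stdAddChar) = N := by
    have h1 := congrFun (ZMod.dft_dft (χ : ZMod N → ℂ)) (-1)
    have h2 : ZMod.dft (χ : ZMod N → ℂ) =
        fun k ↦ gaussSum χ ZMod.stdAddChar * (fun j ↦ χ⁻¹ j) (-k) := by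
      funext k
      rw [hχ.fourierTransform_eq_inv_mul_gaussSum, mul_comm]
    rw [h2, ZMod.dft_const_mul, ZMod.dft_comp_neg] at h1
    simp only [neg_neg, map_one, smul_eq_mul, mul_one] at h1
    rw [← h1, star_gaussSum_eq]
    congr 1
    rw [fourierTransform_eq_gaussSum_mulShift]
    congr 1
    ext j
    simp [AddChar.mulShift_apply, AddChar.inv_apply]
  have h' : ((‖gaussSum χ ZMod.stdAddChar‖ ^ 2 : ℝ) : ℂ) = (N : ℝ) := by
    rw [← Complex.normSq_eq_norm_sq, ← Complex.mul_conj]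
    exact_mod_cast h
  exact_mod_cast h'

theorem IsPrimitive.norm_rootNumber {N : ℕ} [NeZero N] {χ : DirichletCharacter ℂ N}
    (hχ : χ.IsPrimitive) : ‖rootNumber χ‖ = 1 := by
  have hN : (0 : ℝ) < N := by exact_mod_cast NeZero.pos N
  have h : ‖gaussSum χ ZMod.stdAddChar‖ = (N : ℝ) ^ (1 / 2 : ℝ) := by
    rw [← Real.sqrt_eq_rpow, ← hχ.norm_gaussSum_sq, Real.sqrt_sq (norm_nonneg _)]
  rw [rootNumber, norm_div, norm_div, h, norm_pow, norm_I, one_pow, div_one,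
    norm_natCast_cpow_of_pos (NeZero.pos N)]
  norm_num [(Real.rpow_pos_of_pos hN _).ne']

end DirichletCharacter

namespace Complex

theorem norm_rpow_mul_norm_add_one_rpow_le {s : ℂ} {a : ℝ} (ha0 : 0 ≤ a) (ha1 : a ≤ 1) :
    (‖s‖ ^ 2) ^ (1 - a) * (‖s + 1‖ ^ 2) ^ a ≤ ‖s + a‖ ^ 2 + 1 / 4 := by
  have h := Real.geom_mean_le_arith_mean2_weighted (sub_nonneg.2 ha1) ha0 (sq_nonneg ‖s‖)
    (sq_nonneg ‖s + 1‖) (by ring)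
  refine h.trans ?_
  simp only [Complex.sq_norm, normSq_apply, add_re, add_im, one_re, one_im, ofReal_re, ofReal_im]
  nlinarith [sq_nonneg (a - 1 / 2)]

theorem exists_prod_norm_add_natCast_le {c : ℝ} (hc : 0 < c) :
    ∃ C, ∀ (s : ℂ) (a : ℝ) (n : ℕ), c ≤ s.re → 0 ≤ a → a ≤ 1 →
      ∏ j ∈ Finset.range n, ((‖s + j‖) ^ (1 - a) * ‖s + j + 1‖ ^ a) ≤
        C * ∏ j ∈ Finset.range n, ‖s + j + a‖ := by
  have hsum : Summable fun j : ℕ ↦ 1 / (c + j) ^ 2 := by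
    have := (Real.summable_one_div_nat_add_rpow c 2).2 one_lt_two
    refine this.congr fun j ↦ ?_
    rw [Real.rpow_two, sq_abs, add_comm]
  refine ⟨Real.exp (∑' j : ℕ, 1 / (c + j) ^ 2), fun s a n hs ha0 ha1 ↦ ?_⟩
  have hterm (j : ℕ) : ‖s + j‖ ^ (1 - a) * ‖s + j + 1‖ ^ a ≤
      Real.exp (1 / (c + j) ^ 2) * ‖s + j + a‖ := by
    have hre : c + j ≤ ‖s + j + a‖ := by
      refine le_trans ?_ (re_le_norm _)
      simp; linarith
    have hcj : 0 < c + j := by positivity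
    have hpos : 0 < ‖s + j + a‖ := hcj.trans_le hre
    refine le_of_sq_le_sq (α := ℝ) ?_ (by positivity)
    calc (‖s + j‖ ^ (1 - a) * ‖s + j + 1‖ ^ a) ^ 2
        = (‖s + j‖ ^ 2) ^ (1 - a) * (‖s + j + 1‖ ^ 2) ^ a := by
          rw [mul_pow]
          congr 1 <;> simp only [← Real.rpow_natCast, ← Real.rpow_mul (norm_nonneg _)] <;>
            ring_nf
      _ ≤ ‖s + j + a‖ ^ 2 + 1 / 4 := norm_rpow_mul_norm_add_one_rpow_le ha0 ha1
      _ ≤ (2 * (1 / (c + j) ^ 2) + 1) * ‖s + j + a‖ ^ 2 := by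
          have : 1 ≤ 1 / (c + j) ^ 2 * ‖s + j + a‖ ^ 2 := by
            rw [one_div_mul_eq_div, one_le_div (by positivity)]
            gcongr
          linarith
      _ ≤ (Real.exp (1 / (c + j) ^ 2) * ‖s + j + a‖) ^ 2 := by
          rw [mul_pow, ← Real.exp_nat_mul]
          gcongr
          exact_mod_cast Real.add_one_le_exp _
  calc _ ≤ ∏ j ∈ Finset.range n, (Real.exp (1 / (c + j) ^ 2) * ‖s + j + a‖) :=
        Finset.prod_le_prod (fun _ _ ↦ by positivity) fun j _ ↦ hterm j
    _ = Real.exp (∑ j ∈ Finset.range n, 1 / (c + j) ^ 2) * ∏ j ∈ Finset.range n, ‖s + j + a‖ := by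
        rw [Finset.prod_mul_distrib, Real.exp_sum]
    _ ≤ _ := by
        gcongr
        exact hsum.sum_le_tsum _ fun _ _ ↦ by positivity

/-- A uniform upper bound of the expected order for ratios of values of the Gamma function in a
right half-plane. -/
theorem exists_norm_Gamma_add_le {c : ℝ} (hc : 0 < c) :
    ∃ C, 0 < C ∧ ∀ (s : ℂ) (a : ℝ), c ≤ s.re → 0 ≤ a → a ≤ 1 →
      ‖Gamma (s + a)‖ ≤ C * ‖s‖ ^ a * ‖Gamma s‖ := by
  obtain ⟨C, hC⟩ := exists_prod_norm_add_natCast_le hc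
  refine ⟨max C 1, by positivity, fun s a hs ha0 ha1 ↦ ?_⟩
  have hs0 : 0 < s.re := hc.trans_le hs
  have hne (j : ℕ) : 0 < ‖s + j‖ := lt_of_lt_of_le (by simp; positivity) (re_le_norm _)
  have hnea (j : ℕ) : 0 < ‖s + j + a‖ := lt_of_lt_of_le (by simp; positivity) (re_le_norm _)
  have hprod (n : ℕ) : ∏ j ∈ Finset.range n, (‖s + j‖ ^ (1 - a) * ‖s + j + 1‖ ^ a) =
      (∏ j ∈ Finset.range n, ‖s + j‖) * (‖s + n‖ / ‖s‖) ^ a := by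
    induction n with
    | zero => simp [div_self (by simpa using (hne 0).ne' : ‖s‖ ≠ 0)]
    | succ n ih =>
      have h0 := hne 0
      simp only [Nat.cast_zero, add_zero] at h0
      have h1 := hne (n + 1)
      push_cast at h1 ⊢
      rw [← add_assoc] at h1 ⊢
      rw [Finset.prod_range_succ, ih, Finset.prod_range_succ, Real.rpow_sub (hne n),
        Real.rpow_one, Real.div_rpow (norm_nonneg _) (norm_nonneg _),
        Real.div_rpow (norm_nonneg _) (norm_nonneg _)]
      have := Real.rpow_pos_of_pos (hne n) a
      have := Real.rpow_pos_of_pos h0 a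
      field_simp
  have hseq (n : ℕ) (hn : 0 < n) :
      ‖GammaSeq (s + a) n‖ ≤ max C 1 * ‖s‖ ^ a * ‖GammaSeq s n‖ := by
    have h1 := hC s a (n + 1) hs ha0 ha1
    rw [hprod] at h1
    have h0 := hne 0
    simp only [Nat.cast_zero, add_zero] at h0
    have hP : 0 < ∏ j ∈ Finset.range (n + 1), ‖s + j‖ := Finset.prod_pos fun j _ ↦ hne j
    have hQ : 0 < ∏ j ∈ Finset.range (n + 1), ‖s + j + a‖ := Finset.prod_pos fun j _ ↦ hnea j
    have hn' : (n : ℝ) ≤ ‖s + (n + 1 : ℕ)‖ := by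
      refine le_trans ?_ (re_le_norm _)
      simp; linarith
    have h2 : (∏ j ∈ Finset.range (n + 1), ‖s + j‖) * (n : ℝ) ^ a ≤
        max C 1 * ‖s‖ ^ a * ∏ j ∈ Finset.range (n + 1), ‖s + j + a‖ := by
      rw [Real.div_rpow (norm_nonneg _) (norm_nonneg _), ← mul_div_assoc,
        div_le_iff₀ (by positivity)] at h1
      calc _ ≤ (∏ j ∈ Finset.range (n + 1), ‖s + j‖) * ‖s + (n + 1 : ℕ)‖ ^ a := by gcongr
        _ ≤ _ := h1
        _ ≤ max C 1 * (∏ j ∈ Finset.range (n + 1), ‖s + j + a‖) * ‖s‖ ^ a := by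
          gcongr; exact le_max_left _ _
        _ = _ := by ring
    have hcomm : ∀ j : ℕ, s + a + j = s + j + a := fun j ↦ by ring
    simp only [GammaSeq, norm_div, norm_mul, norm_prod, norm_natCast_cpow_of_pos hn, hcomm,
      add_re, ofReal_re, Complex.norm_natCast]
    rw [← mul_div_assoc, div_le_div_iff₀ hQ hP, Real.rpow_add (by positivity)]
    calc _ = (n : ℝ) ^ s.re * n.factorial *
          ((∏ j ∈ Finset.range (n + 1), ‖s + j‖) * (n : ℝ) ^ a) := by ring
      _ ≤ (n : ℝ) ^ s.re * n.factorial *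
          (max C 1 * ‖s‖ ^ a * ∏ j ∈ Finset.range (n + 1), ‖s + j + a‖) := by gcongr
      _ = _ := by ring
  refine le_of_tendsto_of_tendsto (GammaSeq_tendsto_Gamma (s + a)).norm
    ((GammaSeq_tendsto_Gamma s).norm.const_mul _) ?_
  filter_upwards [eventually_gt_atTop 0] with n hn using hseq n hn

theorem norm_Gamma_le_Gamma_re {s : ℂ} (hs : 0 < s.re) : ‖Gamma s‖ ≤ Real.Gamma s.re := by
  rw [Gamma_eq_integral hs, GammaIntegral, Real.Gamma_eq_integral hs]
  refine (MeasureTheory.norm_integral_le_integral_norm _).trans_eq ?_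
  refine MeasureTheory.setIntegral_congr_fun measurableSet_Ioi fun x (hx : 0 < x) ↦ ?_
  simp [norm_cpow_eq_rpow_re_of_pos hx, norm_exp]

theorem norm_sin_le_exp (z : ℂ) : ‖sin z‖ ≤ Real.exp |z.im| := by
  rw [sin, norm_div, norm_mul, norm_I, mul_one, Complex.norm_ofNat, div_le_iff₀ two_pos]
  refine (norm_sub_le _ _).trans ?_
  rw [norm_exp, norm_exp]
  have h1 : (-z * I).re ≤ |z.im| := by simpa using le_abs_self _
  have h2 : (z * I).re ≤ |z.im| := by simpa using neg_le_abs _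
  have := Real.exp_le_exp.2 h1
  have := Real.exp_le_exp.2 h2
  linarith

theorem exists_norm_Gamma_inv_le {b c : ℝ} (hc : c < 1) :
    ∃ C, ∀ s : ℂ, b ≤ s.re → s.re ≤ c → ‖(Gamma s)⁻¹‖ ≤ C * Real.exp (Real.pi * |s.im|) := by
  have hcont : ContinuousOn Real.Gamma (Icc (1 - c) (1 - b)) := fun x hx ↦
    (Real.differentiableOn_Gamma_Ioi.differentiableAt
      (Ioi_mem_nhds ((sub_pos.2 hc).trans_le hx.1))).continuousAt.continuousWithinAt
  obtain ⟨C, hC⟩ := isCompact_Icc.exists_bound_of_continuousOn hcont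
  refine ⟨C / Real.pi, fun s hb hsc ↦ ?_⟩
  have hs : 0 < (1 - s).re := by simp; linarith
  have h1 : ‖Gamma (1 - s)‖ ≤ C := by
    refine (norm_Gamma_le_Gamma_re hs).trans ((le_abs_self _).trans (hC _ ⟨?_, ?_⟩)) <;>
      simp <;> linarith
  have hpi : (Real.pi : ℂ) ≠ 0 := ofReal_ne_zero.2 Real.pi_ne_zero
  have h2 : ‖(Gamma s)⁻¹‖ ≤ ‖Gamma (1 - s) * sin (Real.pi * s) / Real.pi‖ := by
    by_cases hsin : sin (Real.pi * s) = 0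
    · have hG := Gamma_mul_Gamma_one_sub s
      rw [hsin, div_zero, mul_eq_zero] at hG
      rw [hG.resolve_right (Gamma_ne_zero_of_re_pos hs), inv_zero, norm_zero]
      exact norm_nonneg _
    · have hG := Gamma_mul_Gamma_one_sub s
      have h0 : Gamma s ≠ 0 := fun h ↦ by
        rw [h, zero_mul, eq_comm, div_eq_zero_iff] at hG
        tauto
      rw [eq_div_iff hsin] at hG
      refine le_of_eq (congrArg _ ?_)
      rw [eq_div_iff hpi, inv_mul_eq_iff_eq_mul₀ h0, ← mul_assoc, hG]
  refine h2.trans ?_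
  rw [norm_div, norm_mul, norm_real, Real.norm_of_nonneg Real.pi_pos.le, div_mul_eq_mul_div]
  have h3 := norm_sin_le_exp (Real.pi * s)
  rw [im_ofReal_mul, abs_mul, abs_of_pos Real.pi_pos] at h3
  gcongr
  exact (norm_nonneg _).trans h1

theorem norm_Gammaℝ (s : ℂ) :
    ‖Gammaℝ s‖ = Real.pi ^ (-s.re / 2) * ‖Gamma (s / 2)‖ := by
  rw [Gammaℝ_def, norm_mul, norm_cpow_eq_rpow_re_of_pos Real.pi_pos]
  congr 2
  rw [div_ofNat_re, neg_re]

theorem exists_norm_Gammaℝ_one_sub_le {δ : ℝ} (hδ : 0 < δ) (hδ' : δ ≤ 1 / 2) :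
    ∃ C, 0 < C ∧ ∀ s : ℂ, s.re = -δ →
      ‖Gammaℝ (1 - s)‖ ≤ C * (1 + |s.im|) ^ (1 / 2 + δ) * ‖Gammaℝ s‖ ∧
      ‖Gammaℝ (1 - s + 1)‖ ≤ C * (1 + |s.im|) ^ (1 / 2 + δ) * ‖Gammaℝ (s + 1)‖ := by
  obtain ⟨C, hC0, hC⟩ := exists_norm_Gamma_add_le (c := 1 / 4) (by norm_num)
  refine ⟨C, hC0, fun s hs ↦ ?_⟩
  have hpi {x y : ℝ} (h : x ≤ y) : Real.pi ^ x ≤ Real.pi ^ y :=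
    Real.rpow_le_rpow_of_exponent_le (by linarith [Real.pi_gt_three]) h
  have hconj : (starRingEnd ℂ) s = -2 * δ - s := by
    apply Complex.ext <;> simp [hs]; ring
  have hnorm {u : ℂ} (h : |u.re| ≤ 1) (h' : u.im = s.im / 2) : ‖u‖ ≤ 1 + |s.im| := by
    refine (norm_le_abs_re_add_abs_im u).trans ?_
    rw [h', abs_div, abs_two]
    linarith [abs_nonneg s.im]
  constructor
  · rw [norm_Gammaℝ, norm_Gammaℝ, mul_left_comm]
    refine mul_le_mul (hpi (by simp; linarith)) ?_ (norm_nonneg _) (by positivity)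
    have h1 : ‖Gamma ((1 - s) / 2)‖ = ‖Gamma (s / 2 + (1 / 2 + δ : ℝ))‖ := by
      rw [← norm_conj, ← Gamma_conj]
      congr 2
      simp [hconj, map_ofNat]; ring
    have hs0 : s / 2 ≠ 0 := fun h ↦ by
      have := congrArg re h; simp [hs] at this; linarith
    have hs1 : s / 2 + (1 / 2 + δ : ℝ) ≠ 0 := fun h ↦ by
      have := congrArg re h; simp [hs] at this; linarith
    have h2 := hC (s / 2 + 1) (1 / 2 + δ) (by simp [hs]; linarith) (by linarith) (by linarith)
    rw [add_right_comm, Gamma_add_one _ hs0, Gamma_add_one _ hs1, norm_mul, norm_mul] at h2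
    have h3 : ‖s / 2‖ ≤ ‖s / 2 + (1 / 2 + δ : ℝ)‖ := by
      rw [← sq_le_sq₀ (norm_nonneg _) (norm_nonneg _)]
      simp only [Complex.sq_norm, normSq_apply, add_re, add_im, ofReal_re, ofReal_im,
        div_ofNat_re, div_ofNat_im, hs]
      nlinarith
    have h4 : ‖s / 2 + 1‖ ≤ 1 + |s.im| := hnorm (by
      simp only [add_re, div_ofNat_re, one_re, hs]; rw [abs_le]; constructor <;> linarith) (by simp)
    rw [h1]
    refine le_of_mul_le_mul_left (h2.trans ?_) (norm_pos_iff.2 hs1)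
    calc _ ≤ C * (1 + |s.im|) ^ (1 / 2 + δ) *
          (‖s / 2 + (1 / 2 + δ : ℝ)‖ * ‖Gamma (s / 2)‖) := by gcongr
      _ = _ := by ring
  · rw [norm_Gammaℝ, norm_Gammaℝ, mul_left_comm]
    refine mul_le_mul (hpi (by simp; linarith)) ?_ (norm_nonneg _) (by positivity)
    have h1 : ‖Gamma ((1 - s + 1) / 2)‖ = ‖Gamma ((s + 1) / 2 + (1 / 2 + δ : ℝ))‖ := by
      rw [← norm_conj, ← Gamma_conj]
      congr 2
      simp [hconj, map_ofNat]; ring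
    rw [h1]
    refine (hC _ _ (by simp [hs]; linarith) (by linarith) (by linarith)).trans ?_
    have h4 : ‖(s + 1) / 2‖ ≤ 1 + |s.im| := hnorm (by
      simp only [add_re, div_ofNat_re, one_re, hs]; rw [abs_le]; constructor <;> linarith) (by simp)
    gcongr

end Complex

namespace DirichletCharacter

variable {N : ℕ}

theorem exists_norm_gammaFactor_inv_le : ∃ C, ∀ (N : ℕ) (χ : DirichletCharacter ℂ N) (s : ℂ),
    -1 / 2 ≤ s.re → s.re ≤ 3 / 2 → 2 ≤ |s.im| →
      ‖(gammaFactor χ s)⁻¹‖ ≤ C * Real.exp (Real.pi * |s.im|) := by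
  obtain ⟨C, hC⟩ := exists_norm_Gamma_inv_le (b := -3 / 4) (c := 3 / 4) (by norm_num)
  have key {s z : ℂ} (h1 : s.re ≤ 5 / 2) (h2 : -3 / 4 ≤ z.re) (h3 : z.re ≤ 3 / 4)
      (h4 : z.im = s.im / 2) (h5 : ‖(Gamma (s / 2))⁻¹‖ ≤ ‖(Gamma z)⁻¹‖) :
      ‖(Gammaℝ s)⁻¹‖ ≤ Real.pi ^ (5 / 4 : ℝ) * C * Real.exp (Real.pi * |s.im|) := by
    have h6 := h5.trans (hC z h2 h3)
    have hC0 : 0 ≤ C := nonneg_of_mul_nonneg_left ((norm_nonneg _).trans h6) (Real.exp_pos _)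
    rw [norm_inv, norm_Gammaℝ, mul_inv, ← norm_inv, ← Real.rpow_neg Real.pi_pos.le, mul_assoc]
    refine mul_le_mul (Real.rpow_le_rpow_of_exponent_le (by linarith [Real.pi_gt_three])
      (by linarith)) (h6.trans ?_) (norm_nonneg _) (by positivity)
    rw [h4, abs_div, abs_two]
    gcongr
    linarith [abs_nonneg s.im]
  refine ⟨Real.pi ^ (5 / 4 : ℝ) * C, fun N χ s h1 h2 h3 ↦ ?_⟩
  rcases χ.even_or_odd with hχ | hχ
  · rw [hχ.gammaFactor_def]
    exact key (z := s / 2) (by linarith) (by simp; linarith) (by simp; linarith) (by simp) le_rfl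
  · rw [hχ.gammaFactor_def]
    have him : 1 ≤ ‖(s + 1) / 2 - 1‖ := by
      refine le_trans ?_ (abs_im_le_norm _)
      simp [abs_div]; linarith
    have hG := Gamma_add_one ((s + 1) / 2 - 1) (norm_pos_iff.1 (by linarith))
    have hn := key (s := s + 1) (z := (s + 1) / 2 - 1) (by simp; linarith) (by simp; linarith)
      (by simp; linarith) (by simp) (by
        rw [sub_add_cancel] at hG
        rw [hG, mul_inv, norm_mul]
        exact mul_le_of_le_one_left (norm_nonneg _) (by
          rw [norm_inv]; exact inv_le_one_of_one_le₀ him))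
    simpa using hn

theorem gammaFactor_ne_zero_of_re_pos (χ : DirichletCharacter ℂ N) {s : ℂ} (hs : 0 < s.re) :
    gammaFactor χ s ≠ 0 := by
  rcases χ.even_or_odd with hχ | hχ <;> rw [hχ.gammaFactor_def]
  · exact Gammaℝ_ne_zero_of_re_pos hs
  · exact Gammaℝ_ne_zero_of_re_pos (by simp; linarith)

theorem norm_LFunction_le_tsum [NeZero N] (χ : DirichletCharacter ℂ N) {s : ℂ} (hs : 1 < s.re) :
    ‖LFunction χ s‖ ≤ ∑' n : ℕ, 1 / (n : ℝ) ^ s.re := by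
  rw [LFunction_eq_LSeries χ hs, LSeries]
  refine tsum_of_norm_bounded (Real.summable_one_div_nat_rpow.2 hs).hasSum fun n ↦ ?_
  refine (LSeries.norm_term_le s (g := 1) (by simpa using χ.norm_le_one _)).trans ?_
  rw [LSeries.norm_term_eq]
  split_ifs with h
  · positivity
  · simp

theorem exists_norm_LFunction_le_of_re_eq_neg {δ : ℝ} (hδ : 0 < δ) (hδ' : δ ≤ 1 / 2) :
    ∃ C, 0 < C ∧ ∀ (N : ℕ) [NeZero N] (χ : DirichletCharacter ℂ N), χ.IsPrimitive → χ ≠ 1 →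
      ∀ s : ℂ, s.re = -δ →
        ‖LFunction χ s‖ ≤ C * (N * (1 + |s.im|)) ^ (1 / 2 + δ) := by
  obtain ⟨C, hC0, hC⟩ := exists_norm_Gammaℝ_one_sub_le hδ hδ'
  set Z := ∑' n : ℕ, 1 / (n : ℝ) ^ (1 + δ)
  have hZ0 : 0 ≤ Z := tsum_nonneg fun n ↦ by positivity
  refine ⟨C * Z + 1, by positivity, fun N _ χ hχ hχ1 s hs ↦ ?_⟩
  have hN : N ≠ 1 := fun h ↦ hχ1 (by subst h; exact level_one χ)
  have hre : (1 - s).re = 1 + δ := by simp [hs]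
  have hZ : ‖LFunction χ⁻¹ (1 - s)‖ ≤ Z := by
    have := norm_LFunction_le_tsum χ⁻¹ (s := 1 - s) (by linarith)
    rwa [hre] at this
  have hγ : ‖gammaFactor χ⁻¹ (1 - s)‖ ≤ C * (1 + |s.im|) ^ (1 / 2 + δ) * ‖gammaFactor χ s‖ := by
    rcases χ.even_or_odd with h | h
    · have h' : χ⁻¹.Even := by simpa [Even, MulChar.inv_apply_eq_inv'] using h
      rw [h.gammaFactor_def, h'.gammaFactor_def]
      exact (hC s hs).1
    · have h' : χ⁻¹.Odd := by
        rw [Odd, MulChar.inv_apply_eq_inv', show χ (-1) = -1 from h]; norm_num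
      rw [h.gammaFactor_def, h'.gammaFactor_def]
      exact (hC s hs).2
  have hΛ : completedLFunction χ⁻¹ (1 - s) = LFunction χ⁻¹ (1 - s) * gammaFactor χ⁻¹ (1 - s) := by
    rw [LFunction_eq_completed_div_gammaFactor _ _ (.inr hN),
      div_mul_cancel₀ _ (gammaFactor_ne_zero_of_re_pos _ (by linarith))]
  have hFE := hχ.completedLFunction_one_sub (1 - s)
  rw [sub_sub_cancel, hΛ] at hFE
  rw [LFunction_eq_completed_div_gammaFactor _ _ (.inr hN), hFE, norm_div]
  refine div_le_of_le_mul₀ (norm_nonneg _) (by positivity) ?_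
  have hexp : (1 - s - 1 / 2 : ℂ).re = 1 / 2 + δ := by
    rw [sub_re, hre]; norm_num; ring
  rw [norm_mul, norm_mul, norm_mul, hχ.norm_rootNumber, mul_one,
    norm_natCast_cpow_of_pos (NeZero.pos N), hexp, Real.mul_rpow (by positivity) (by positivity)]
  calc _ ≤ (N : ℝ) ^ (1 / 2 + δ) *
        (Z * (C * (1 + |s.im|) ^ (1 / 2 + δ) * ‖gammaFactor χ s‖)) := by gcongr
    _ = C * Z * ((N : ℝ) ^ (1 / 2 + δ) * (1 + |s.im|) ^ (1 / 2 + δ)) * ‖gammaFactor χ s‖ := by ring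
    _ ≤ _ := by gcongr; linarith

end DirichletCharacter

theorem Nat.exists_two_pow_card_primeFactors_le {ε : ℝ} (hε : 0 < ε) :
    ∃ K : ℝ, ∀ n : ℕ, n ≠ 0 → (2 : ℝ) ^ n.primeFactors.card ≤ K * (n : ℝ) ^ ε := by
  obtain ⟨P, hP⟩ := exists_nat_ge ((2 : ℝ) ^ (1 / ε))
  refine ⟨2 ^ P, fun n hn ↦ ?_⟩
  have hterm (p : ℕ) (hp : p ∈ n.primeFactors) :
      (2 : ℝ) ≤ (if p < P then 2 else 1) * (p : ℝ) ^ ε := by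
    have hp1 : (1 : ℝ) ≤ p := by exact_mod_cast (Nat.prime_of_mem_primeFactors hp).one_le
    split_ifs with h
    · have := Real.one_le_rpow hp1 hε.le
      linarith
    · have h2 : (2 : ℝ) ^ (1 / ε) ≤ p := hP.trans (by exact_mod_cast not_lt.1 h)
      calc (2 : ℝ) = ((2 : ℝ) ^ (1 / ε)) ^ ε := by
            rw [← Real.rpow_mul two_pos.le, one_div_mul_cancel hε.ne', Real.rpow_one]
        _ ≤ 1 * (p : ℝ) ^ ε := by rw [one_mul]; gcongr
  calc (2 : ℝ) ^ n.primeFactors.card = ∏ _p ∈ n.primeFactors, (2 : ℝ) := by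
        rw [Finset.prod_const]
    _ ≤ ∏ p ∈ n.primeFactors, ((if p < P then 2 else 1) * (p : ℝ) ^ ε) :=
        Finset.prod_le_prod (fun _ _ ↦ two_pos.le) hterm
    _ = 2 ^ (n.primeFactors.filter (· < P)).card * (∏ p ∈ n.primeFactors, (p : ℝ)) ^ ε := by
        rw [Finset.prod_mul_distrib, Finset.prod_ite, Finset.prod_const, Finset.prod_const_one,
          mul_one, Real.finsetProd_rpow _ _ fun _ _ ↦ by positivity]
    _ ≤ 2 ^ P * (n : ℝ) ^ ε := by
        gcongr
        · exact one_le_two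
        · refine (Finset.card_le_card fun p hp ↦ ?_).trans_eq (Finset.card_range P)
          exact Finset.mem_range.2 (Finset.mem_filter.1 hp).2
        · rw [← Nat.cast_prod]
          exact Nat.cast_le.2 (Nat.le_of_dvd (Nat.pos_of_ne_zero hn) (Nat.prod_primeFactors_dvd n))

namespace DirichletCharacter

theorem exists_norm_LFunction_le_exp {N : ℕ} [NeZero N] {χ : DirichletCharacter ℂ N} (hχ : χ ≠ 1) :
    ∃ C, ∀ s : ℂ, -1 / 2 ≤ s.re → s.re ≤ 3 / 2 → 2 ≤ |s.im| →
      ‖LFunction χ s‖ ≤ C * Real.exp (Real.pi * |s.im|) := by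
  obtain ⟨A, hA⟩ := exists_norm_completedLFunction_le hχ (-1 / 2) (3 / 2)
  obtain ⟨B, hB⟩ := exists_norm_gammaFactor_inv_le
  refine ⟨A * B, fun s h1 h2 h3 ↦ ?_⟩
  have hN : N ≠ 1 := fun h ↦ hχ (by subst h; exact level_one χ)
  rw [LFunction_eq_completed_div_gammaFactor _ _ (.inr hN), div_eq_mul_inv, norm_mul, mul_assoc]
  exact mul_le_mul (hA s h1 h2) (hB N χ s h1 h2 h3) (norm_nonneg _)
    ((norm_nonneg _).trans (hA s h1 h2))

/-- The convexity bound for `L`-functions of primitive Dirichlet characters. -/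
theorem exists_norm_LFunction_le_of_isPrimitive {δ : ℝ} (hδ : 0 < δ) (hδ' : δ ≤ 1 / 2) :
    ∃ C, 0 < C ∧ ∀ (N : ℕ) [NeZero N] (χ : DirichletCharacter ℂ N), χ.IsPrimitive → χ ≠ 1 →
      ∀ s : ℂ, 1 / 2 ≤ s.re → s.re ≤ 1 → 1 ≤ |s.im| →
        ‖LFunction χ s‖ ≤ C * (N * |s.im|) ^ ((1 + δ - s.re) / 2) := by
  obtain ⟨C, hC0, hC⟩ := exists_norm_LFunction_le_of_re_eq_neg hδ hδ'
  set Z := ∑' n : ℕ, 1 / (n : ℝ) ^ (1 + δ) with hZ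
  have hZ0 : 0 ≤ Z := tsum_nonneg fun n ↦ by positivity
  refine ⟨2 * C * Real.exp 5 + Z * Real.exp 4, by positivity,
    fun N _ χ hχ hχ1 s hs1 hs2 ht ↦ ?_⟩
  set X : ℝ := N * |s.im| with hX
  have hN1 : (1 : ℝ) ≤ N := by exact_mod_cast NeZero.one_le
  have hX1 : 1 ≤ X := one_le_mul_of_one_le_of_one_le hN1 ht
  have hX0 : 0 < X := by linarith
  set F : ℂ → ℂ := fun z ↦ LFunction χ z * (exp ((z - s) ^ 2) * (X : ℂ) ^ ((z - s) / 2)) with hF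
  have hexp (z : ℂ) (h1 : -δ ≤ z.re) (h2 : z.re ≤ 1 + δ) :
      ‖exp ((z - s) ^ 2)‖ ≤ Real.exp (4 - (z.im - s.im) ^ 2) := by
    rw [norm_exp, Real.exp_le_exp, sq, mul_re, sub_re, sub_im]
    nlinarith
  have hcpow (z : ℂ) : ‖(X : ℂ) ^ ((z - s) / 2)‖ = X ^ ((z.re - s.re) / 2) := by
    rw [norm_cpow_eq_rpow_re_of_pos hX0]
    simp
  have hFs : F s = LFunction χ s := by simp [hF]
  rw [← hFs]
  have hXpos := Real.rpow_pos_of_pos hX0 ((1 + δ - s.re) / 2)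
  refine PhragmenLindelof.vertical_strip (a := -δ) (b := 1 + δ) ?_ ?_ ?_ ?_ (by linarith)
    (by linarith)
  · refine Differentiable.diffContOnCl ?_
    refine (differentiable_LFunction hχ1).mul (.mul (by fun_prop) ?_)
    refine Differentiable.const_cpow (by fun_prop) (.inl (ofReal_ne_zero.2 hX0.ne'))
  · obtain ⟨A, hA⟩ := exists_norm_LFunction_le_exp hχ1
    refine ⟨1, ?_, Real.pi, Asymptotics.IsBigO.of_bound (A * (Real.exp 4 * X)) ?_⟩
    · rw [lt_div_iff₀ (by linarith)]
      linarith [Real.pi_gt_three]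
    · have hev : ∀ᶠ z : ℂ in comap (_root_.abs ∘ im) atTop, 2 ≤ |z.im| :=
        tendsto_comap.eventually (eventually_ge_atTop 2)
      filter_upwards [hev.filter_mono inf_le_left, mem_inf_of_right (mem_principal_self _)]
        with z hz1 hz2
      have hL := hA z (by linarith [hz2.1]) (by linarith [hz2.2]) hz1
      have hE : ‖exp ((z - s) ^ 2)‖ ≤ Real.exp 4 :=
        (hexp z hz2.1.le hz2.2.le).trans (Real.exp_le_exp.2 (by nlinarith))
      have hP : ‖(X : ℂ) ^ ((z - s) / 2)‖ ≤ X := by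
        rw [hcpow]
        refine (Real.rpow_le_rpow_of_exponent_le hX1 ?_).trans_eq (Real.rpow_one X)
        linarith [hz2.2]
      rw [hF, norm_mul, norm_mul, Real.norm_of_nonneg (Real.exp_pos _).le, one_mul]
      calc _ ≤ A * Real.exp (Real.pi * |z.im|) * (Real.exp 4 * X) := by
            refine mul_le_mul hL (by gcongr) (by positivity) ((norm_nonneg _).trans hL)
        _ = A * (Real.exp 4 * X) * Real.exp (Real.pi * |z.im|) := by ring
        _ ≤ _ := by
            have hA0 : 0 ≤ A := nonneg_of_mul_nonneg_left ((norm_nonneg _).trans hL)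
              (Real.exp_pos _)
            gcongr
            linarith [Real.add_one_le_exp |z.im|]
  · intro z hz
    have hL := hC N χ hχ hχ1 z hz
    have hE := hexp z hz.ge (by linarith)
    set v := z.im - s.im with hv
    have hy : N * (1 + |z.im|) ≤ 2 * X * Real.exp |v| := by
      have h1 : |z.im| ≤ |s.im| + |v| := by
        rw [hv]
        exact (congrArg _ (by ring)).trans_le (abs_add_le s.im (z.im - s.im))
      have h2 : 1 + |z.im| ≤ 2 * |s.im| * (|v| + 1) := by
        nlinarith [abs_nonneg v]
      calc N * (1 + |z.im|) ≤ N * (2 * |s.im| * Real.exp |v|) := by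
            gcongr
            exact h2.trans (by gcongr; exact Real.add_one_le_exp _)
        _ = _ := by rw [hX]; ring
    have hy' : (N * (1 + |z.im|)) ^ (1 / 2 + δ) ≤ 2 * Real.exp |v| * X ^ (1 / 2 + δ) := by
      refine (Real.rpow_le_rpow (by positivity) hy (by positivity)).trans ?_
      rw [mul_right_comm, Real.mul_rpow (by positivity) hX0.le]
      gcongr
      refine Real.rpow_le_self_of_one_le ?_ (by linarith)
      linarith [Real.one_le_exp (abs_nonneg v)]
    rw [hF, norm_mul, norm_mul, hcpow, hz]
    calc _ ≤ C * (2 * Real.exp |v| * X ^ (1 / 2 + δ)) *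
          (Real.exp (4 - v ^ 2) * X ^ ((-δ - s.re) / 2)) := by gcongr; exact hL.trans (by gcongr)
      _ = 2 * C * (Real.exp |v| * Real.exp (4 - v ^ 2)) *
          (X ^ (1 / 2 + δ) * X ^ ((-δ - s.re) / 2)) := by ring
      _ = 2 * C * Real.exp (|v| + (4 - v ^ 2)) * X ^ ((1 + δ - s.re) / 2) := by
          rw [← Real.exp_add, ← Real.rpow_add hX0]
          congr 2
          ring
      _ ≤ 2 * C * Real.exp 5 * X ^ ((1 + δ - s.re) / 2) := by
          gcongr
          nlinarith [sq_abs v, sq_nonneg (|v| - 1 / 2)]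
      _ ≤ _ := by
          gcongr
          linarith [mul_nonneg hZ0 (Real.exp_pos 4).le]
  · intro z hz
    have hL := norm_LFunction_le_tsum χ (s := z) (by linarith)
    rw [hz, ← hZ] at hL
    have hE : ‖exp ((z - s) ^ 2)‖ ≤ Real.exp 4 :=
      (hexp z (by linarith) hz.le).trans (Real.exp_le_exp.2 (by nlinarith))
    rw [hF, norm_mul, norm_mul, hcpow, hz, ← mul_assoc]
    gcongr
    calc _ ≤ Z * Real.exp 4 := by gcongr
      _ ≤ _ := le_add_of_nonneg_left (by positivity)

theorem norm_LFunction_le_norm_LFunction_primitiveCharacter_mul {N : ℕ} [NeZero N]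
    (χ : DirichletCharacter ℂ N) [NeZero χ.conductor] {s : ℂ} (hs : 0 ≤ s.re) (hs1 : s ≠ 1) :
    ‖LFunction χ s‖ ≤ ‖LFunction χ.primitiveCharacter s‖ * 2 ^ N.primeFactors.card := by
  have h := LFunction_changeLevel χ.conductor_dvd_level χ.primitiveCharacter (.inr hs1)
  rw [changeLevel_primitiveCharacter] at h
  rw [h, norm_mul, norm_prod, ← Finset.prod_const]
  gcongr with p hp
  have hp0 := (Nat.prime_of_mem_primeFactors hp).pos
  calc _ ≤ ‖(1 : ℂ)‖ + ‖χ.primitiveCharacter p * (p : ℂ) ^ (-s)‖ := norm_sub_le _ _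
    _ ≤ 1 + 1 * 1 := by
        rw [norm_one, norm_mul, norm_natCast_cpow_of_pos hp0]
        gcongr
        · exact norm_le_one _ _
        · exact Real.rpow_le_one_of_one_le_of_nonpos (by exact_mod_cast hp0) (by simpa using hs)
    _ = 2 := by norm_num

end DirichletCharacter

theorem LFunction_subconvexity_bound :
    ∀ ε : ℝ, 0 < ε → ∃ K : ℝ, ∀ (a : ℕ) [NeZero a] (χ : DirichletCharacter ℂ a), χ ≠ 1 →
      ∀ s : ℂ, 1 / 2 ≤ s.re → s.re ≤ 1 → 1 ≤ |s.im| →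
        ‖DirichletCharacter.LFunction χ s‖
          ≤ K * ((a : ℝ) * |s.im|) ^ ((1 - s.re) / 2 + ε) := by
  intro ε hε
  set δ := min ε (1 / 2)
  obtain ⟨C, hC0, hC⟩ := DirichletCharacter.exists_norm_LFunction_le_of_isPrimitive
    (δ := δ) (by positivity) (min_le_right _ _)
  obtain ⟨K, hK⟩ := Nat.exists_two_pow_card_primeFactors_le (half_pos hε)
  refine ⟨C * K, fun a _ χ hχ s hs1 hs2 ht ↦ ?_⟩
  have : NeZero χ.conductor := ⟨χ.conductor_ne_zero⟩
  have hq : χ.primitiveCharacter ≠ 1 := fun h ↦ hχ <| by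
    rw [← χ.changeLevel_primitiveCharacter, h, map_one]
  have ha : (1 : ℝ) ≤ a := by exact_mod_cast NeZero.one_le
  have hX : 1 ≤ (a : ℝ) * |s.im| := one_le_mul_of_one_le_of_one_le ha ht
  have hδε : δ ≤ ε := min_le_left _ _
  have hδ0 : 0 < δ := by positivity
  have hL := hC _ _ χ.primitiveCharacter_isPrimitive hq s hs1 hs2 ht
  have hqa : (χ.conductor : ℝ) ≤ a := by
    exact_mod_cast Nat.le_of_dvd (NeZero.pos a) χ.conductor_dvd_level
  have hK' := hK a (NeZero.ne a)
  have hK0 : 0 ≤ K := nonneg_of_mul_nonneg_left ((by positivity : (0 : ℝ) ≤ 2 ^ _).trans hK')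
    (by positivity)
  calc _ ≤ _ := χ.norm_LFunction_le_norm_LFunction_primitiveCharacter_mul (by linarith)
        fun h ↦ by norm_num [h] at ht
    _ ≤ C * ((a : ℝ) * |s.im|) ^ ((1 - s.re) / 2 + ε / 2) *
        (K * ((a : ℝ) * |s.im|) ^ (ε / 2)) := by
      gcongr
      · refine hL.trans ?_
        gcongr
        refine (Real.rpow_le_rpow (by positivity) (by gcongr) (by linarith)).trans
          (Real.rpow_le_rpow_of_exponent_le hX (by linarith))
      · refine hK'.trans ?_
        gcongr
        exact le_mul_of_one_le_right (by linarith) ht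
    _ = _ := by
      rw [mul_mul_mul_comm, ← Real.rpow_add (by linarith)]
      ring_nf
end

section
/- Let $a > 1$ be an integer. Then $\frac{1}{\phi(a)} \sum_{\substack{\chi \ (\mathrm{mod}\ a) \\ \chi \ne \chi_0}} \overline{\chi}(-1)\, L(1,\chi) = -\frac{1}{a}\left(\frac{\Gamma'((a-1)/a)}{\Gamma((a-1)/a)} + \sum_{p \mid a} \frac{\log p}{p-1} + \log a + \gamma\right)$, where the outer sum runs over all non-principal Dirichlet characters $\chi$ modulo $a$ and the inner sum over primes $p$ dividing $a$. -/
open Finset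
open scoped Classical

open Filter Topology

theorem Real.differentiableAt_Gamma_of_pos {x : ℝ} (hx : 0 < x) :
    DifferentiableAt ℝ Real.Gamma x :=
  Real.differentiableAt_Gamma fun m => by
    have : (0 : ℝ) ≤ m := m.cast_nonneg
    linarith

theorem Real.logDeriv_Gamma_add_one {x : ℝ} (hx : 0 < x) :
    logDeriv Real.Gamma (x + 1) = logDeriv Real.Gamma x + 1 / x := by
  have hd : HasDerivAt (fun y => Real.Gamma (y + 1)) (deriv Real.Gamma (x + 1)) x :=
    (Real.differentiableAt_Gamma_of_pos (by linarith)).hasDerivAt.comp_add_const x 1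
  have hm : HasDerivAt (fun y => y * Real.Gamma y)
      (1 * Real.Gamma x + x * deriv Real.Gamma x) x :=
    (hasDerivAt_id x).mul (Real.differentiableAt_Gamma_of_pos hx).hasDerivAt
  have he : (fun y => Real.Gamma (y + 1)) =ᶠ[𝓝 x] fun y => y * Real.Gamma y := by
    filter_upwards [eventually_gt_nhds hx] with y hy using Real.Gamma_add_one hy.ne'
  have h := hd.unique (hm.congr_of_eventuallyEq he)
  have hG := (Real.Gamma_pos_of_pos hx).ne'
  rw [logDeriv_apply, logDeriv_apply, h, Real.Gamma_add_one hx.ne']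
  field_simp
  ring

theorem Real.hasDerivAt_log_comp_Gamma {x : ℝ} (hx : 0 < x) :
    HasDerivAt (Real.log ∘ Real.Gamma) (logDeriv Real.Gamma x) x :=
  (Real.differentiableAt_Gamma_of_pos hx).hasDerivAt.log (Real.Gamma_pos_of_pos hx).ne'

theorem Real.slope_log_comp_Gamma {x : ℝ} (hx : 0 < x) :
    slope (Real.log ∘ Real.Gamma) x (x + 1) = Real.log x := by
  rw [slope_def_field, Function.comp_apply, Function.comp_apply, Real.Gamma_add_one hx.ne',
    Real.log_mul hx.ne' (Real.Gamma_pos_of_pos hx).ne']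
  ring

theorem Real.logDeriv_Gamma_le_log {x : ℝ} (hx : 0 < x) :
    logDeriv Real.Gamma x ≤ Real.log x := by
  rw [← Real.slope_log_comp_Gamma hx]
  exact Real.convexOn_log_Gamma.le_slope_of_hasDerivAt hx (Set.mem_Ioi.2 (by linarith))
    (by linarith) (Real.hasDerivAt_log_comp_Gamma hx)

theorem Real.log_le_logDeriv_Gamma_add_one {x : ℝ} (hx : 0 < x) :
    Real.log x ≤ logDeriv Real.Gamma (x + 1) := by
  rw [← Real.slope_log_comp_Gamma hx]
  exact Real.convexOn_log_Gamma.slope_le_of_hasDerivAt hx (Set.mem_Ioi.2 (by linarith))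
    (by linarith) (Real.hasDerivAt_log_comp_Gamma (by linarith))

theorem Real.tendsto_logDeriv_Gamma_nat_add_sub_log {x : ℝ} (hx : 0 < x) :
    Tendsto (fun n : ℕ => logDeriv Real.Gamma (n + x) - Real.log n) atTop (𝓝 0) := by
  have hlog (y : ℝ) : Tendsto (fun n : ℕ => Real.log (n + y) - Real.log n) atTop (𝓝 0) :=
    (Real.tendsto_log_comp_add_sub_log y).comp tendsto_natCast_atTop_atTop
  refine tendsto_of_tendsto_of_tendsto_of_le_of_le' (hlog (x - 1)) (hlog x) ?_ ?_
  · filter_upwards [eventually_ge_atTop 1] with n hn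
    have hn' : (1 : ℝ) ≤ n := by exact_mod_cast hn
    have := Real.log_le_logDeriv_Gamma_add_one (x := n + (x - 1)) (by linarith)
    rw [show (n : ℝ) + (x - 1) + 1 = n + x by ring] at this
    linarith
  · filter_upwards with n
    have := Real.logDeriv_Gamma_le_log (x := n + x) (by positivity)
    linarith

theorem Real.logDeriv_Gamma_nat_add {x : ℝ} (hx : 0 < x) (n : ℕ) :
    logDeriv Real.Gamma (n + x) = logDeriv Real.Gamma x + ∑ m ∈ range n, 1 / (m + x) := by
  induction n with
  | zero => simp
  | succ n ih =>
    rw [sum_range_succ, ← add_assoc, ← ih,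
      ← Real.logDeriv_Gamma_add_one (by positivity : 0 < (n : ℝ) + x)]
    push_cast
    ring_nf

theorem Real.logDeriv_Gamma_one : logDeriv Real.Gamma 1 = -Real.eulerMascheroniConstant := by
  rw [logDeriv_apply, Real.hasDerivAt_Gamma_one.deriv, Real.Gamma_one, div_one]

/-- The partial fraction expansion of the digamma function. -/
theorem Real.tendsto_sum_one_div_sub_one_div {x : ℝ} (hx : 0 < x) :
    Tendsto (fun n : ℕ => ∑ m ∈ range n, (1 / ((m : ℝ) + x) - 1 / ((m : ℝ) + 1))) atTop
      (𝓝 (-logDeriv Real.Gamma x - Real.eulerMascheroniConstant)) := by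
  have h := ((Real.tendsto_logDeriv_Gamma_nat_add_sub_log hx).sub
    (Real.tendsto_logDeriv_Gamma_nat_add_sub_log one_pos)).add_const
      (-logDeriv Real.Gamma x - Real.eulerMascheroniConstant)
  rw [sub_zero, zero_add] at h
  refine h.congr fun n => ?_
  rw [Real.logDeriv_Gamma_nat_add hx, Real.logDeriv_Gamma_nat_add one_pos,
    Real.logDeriv_Gamma_one, sum_sub_distrib]
  ring

theorem DirichletCharacter.sum_conj_apply_neg_one_mul_LFunction (a : ℕ) [NeZero a] (s : ℂ) :
    ∑ χ : DirichletCharacter ℂ a, (starRingEnd ℂ) (χ (-1)) * DirichletCharacter.LFunction χ s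
      = a.totient * ((a : ℂ) ^ (-s) * HurwitzZeta.hurwitzZeta (ZMod.toAddCircle (-1 : ZMod a)) s) := by
  have hu : IsUnit (-1 : ZMod a) := isUnit_one.neg
  have hconj (χ : DirichletCharacter ℂ a) : (starRingEnd ℂ) (χ (-1)) = χ (-1)⁻¹ := by
    have hinv : (-1 : ZMod a)⁻¹ = -1 := by
      rw [ZMod.inv_eq_of_mul_eq_one]
      ring
    rcases χ.even_or_odd with h | h <;> rw [hinv, h] <;> simp
  calc _ = ∑ χ : DirichletCharacter ℂ a, ∑ j : ZMod a, (χ (-1)⁻¹ * χ j) *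
          ((a : ℂ) ^ (-s) * HurwitzZeta.hurwitzZeta (ZMod.toAddCircle j) s) := by
        refine sum_congr rfl fun χ _ => ?_
        rw [hconj, DirichletCharacter.LFunction, ZMod.LFunction, mul_sum, mul_sum]
        exact sum_congr rfl fun j _ => by ring
    _ = _ := by
        rw [sum_comm]
        simp_rw [← sum_mul, DirichletCharacter.sum_char_inv_mul_char_eq ℂ hu]
        simp

theorem Real.norm_one_div_rpow_sub_le {x s : ℝ} (hx : 0 < x) (hx1 : x ≤ 1) (hs : 1 ≤ s)
    (hs2 : s ≤ 2) (n : ℕ) :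
    ‖1 / ((n : ℝ) + x) ^ s - 1 / ((n : ℝ) + 1) ^ s‖ ≤ 2 / x ^ 2 * (1 / ((n : ℝ) + 1) ^ 2) := by
  set u : ℝ := n + x with hu
  set v : ℝ := n + 1 with hv
  have hn : (0 : ℝ) ≤ n := n.cast_nonneg
  have hu0 : 0 < u := by positivity
  have hv0 : 0 < v := by positivity
  have huv : u / v ≤ 1 := (div_le_one hv0).2 (by linarith)
  have hq0 : 0 < u / v := by positivity
  have hxu : x * v ≤ u := by rw [hu, hv]; nlinarith
  have hfac : 1 / u ^ s - 1 / v ^ s = 1 / u ^ s * (1 - (u / v) ^ s) := by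
    rw [Real.div_rpow hu0.le hv0.le]
    have := (Real.rpow_pos_of_pos hu0 s).ne'
    field_simp
  have hlow : (u / v) ^ 2 ≤ (u / v) ^ s := by
    rw [← Real.rpow_two]
    exact Real.rpow_le_rpow_of_exponent_ge hq0 huv hs2
  have hhigh : (u / v) ^ s ≤ 1 := Real.rpow_le_one hq0.le huv (by linarith)
  have hgap : 1 - (u / v) ^ s ≤ 2 * (1 / v) := by
    have : 1 - u / v ≤ 1 / v := by
      rw [one_sub_div hv0.ne']
      gcongr
      linarith
    nlinarith
  have hdecay : 1 / u ^ s ≤ 1 / x ^ 2 * (1 / v) := by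
    have hxs : x ^ 2 ≤ x ^ s := by
      rw [← Real.rpow_two]
      exact Real.rpow_le_rpow_of_exponent_ge hx hx1 hs2
    have hvs : v ≤ v ^ s := Real.self_le_rpow_of_one_le (by linarith) hs
    have : x ^ 2 * v ≤ u ^ s :=
      calc x ^ 2 * v ≤ x ^ s * v ^ s := by gcongr
        _ = (x * v) ^ s := (Real.mul_rpow hx.le hv0.le).symm
        _ ≤ u ^ s := Real.rpow_le_rpow (by positivity) hxu (by linarith)
    rw [one_div_mul_one_div]
    exact one_div_le_one_div_of_le (by positivity) this
  rw [hfac, Real.norm_of_nonneg (mul_nonneg (by positivity) (by linarith))]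
  calc 1 / u ^ s * (1 - (u / v) ^ s) ≤ (1 / x ^ 2 * (1 / v)) * (2 * (1 / v)) := by
        gcongr
    _ = _ := by field_simp

theorem Real.summable_two_div_sq_mul_one_div_sq (x : ℝ) :
    Summable fun n : ℕ => 2 / x ^ 2 * (1 / ((n : ℝ) + 1) ^ 2) := by
  refine Summable.mul_left _ ?_
  exact_mod_cast (summable_nat_add_iff 1).2 (Real.summable_one_div_nat_pow.2 one_lt_two)

theorem Real.tendsto_tsum_one_div_rpow_sub {x : ℝ} (hx : 0 < x) (hx1 : x ≤ 1) :
    Tendsto (fun s : ℝ => ∑' n : ℕ, (1 / ((n : ℝ) + x) ^ s - 1 / ((n : ℝ) + 1) ^ s)) (𝓝[>] 1)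
      (𝓝 (-logDeriv Real.Gamma x - Real.eulerMascheroniConstant)) := by
  have hsum : Summable fun n : ℕ => 1 / ((n : ℝ) + x) - 1 / ((n : ℝ) + 1) :=
    (Real.summable_two_div_sq_mul_one_div_sq x).of_norm_bounded fun n => by
      simpa using Real.norm_one_div_rpow_sub_le hx hx1 le_rfl one_le_two n
  rw [← tendsto_nhds_unique hsum.hasSum.tendsto_sum_nat
    (Real.tendsto_sum_one_div_sub_one_div hx)]
  refine tendsto_tsum_of_dominated_convergence (Real.summable_two_div_sq_mul_one_div_sq x)
    (fun n => ?_) ?_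
  · have hcont {y : ℝ} (hy : 0 < y) :
        Tendsto (fun s : ℝ => 1 / y ^ s) (𝓝[>] 1) (𝓝 (1 / y)) := by
      have h : ContinuousAt (fun s : ℝ => 1 / y ^ s) 1 :=
        continuousAt_const.div (Real.continuousAt_const_rpow hy.ne')
          (Real.rpow_pos_of_pos hy _).ne'
      simpa [ContinuousAt] using h.mono_left nhdsWithin_le_nhds
    exact (hcont (by positivity)).sub (hcont (by positivity))
  · filter_upwards [Ioo_mem_nhdsGT (one_lt_two (α := ℝ))] with s hs n
    exact Real.norm_one_div_rpow_sub_le hx hx1 hs.1.le hs.2.le n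

theorem HurwitzZeta.hurwitzZeta_sub_hurwitzZeta_zero_ofReal {x s : ℝ} (hx : 0 < x) (hx1 : x ≤ 1)
    (hs : 1 < s) :
    HurwitzZeta.hurwitzZeta (x : UnitAddCircle) s - HurwitzZeta.hurwitzZeta 0 s =
      ((∑' n : ℕ, (1 / ((n : ℝ) + x) ^ s - 1 / ((n : ℝ) + 1) ^ s) : ℝ) : ℂ) := by
  have hs' : 1 < (s : ℂ).re := by simpa using hs
  have h := (HurwitzZeta.hasSum_hurwitzZeta_of_one_lt_re ⟨hx.le, hx1⟩ hs').sub
    (HurwitzZeta.hasSum_hurwitzZeta_of_one_lt_re (a := 1) ⟨zero_le_one, le_rfl⟩ hs')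
  rw [AddCircle.coe_period] at h
  rw [← h.tsum_eq, Complex.ofReal_tsum]
  refine tsum_congr fun n => ?_
  push_cast
  rw [Complex.ofReal_cpow (by positivity), Complex.ofReal_cpow (by positivity)]
  push_cast
  rfl

theorem Complex.tendsto_ofReal_nhdsGT (x : ℝ) :
    Tendsto (fun s : ℝ => (s : ℂ)) (𝓝[>] x) (𝓝[≠] (x : ℂ)) := by
  refine tendsto_nhdsWithin_iff.2
    ⟨(Complex.continuous_ofReal.tendsto x).mono_left nhdsWithin_le_nhds, ?_⟩
  filter_upwards [self_mem_nhdsWithin] with s hs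
  exact fun h => (ne_of_gt hs) (Complex.ofReal_injective h)

/-- The difference of the constant terms at `s = 1` of the Hurwitz and Riemann zeta functions. -/
theorem HurwitzZeta.hurwitzZeta_one_sub_hurwitzZeta_zero_one {x : ℝ} (hx : 0 < x) (hx1 : x ≤ 1) :
    HurwitzZeta.hurwitzZeta (x : UnitAddCircle) 1 - HurwitzZeta.hurwitzZeta 0 1 =
      ((-logDeriv Real.Gamma x - Real.eulerMascheroniConstant : ℝ) : ℂ) := by
  have hleft := ((HurwitzZeta.differentiable_hurwitzZeta_sub_hurwitzZeta
    (x : UnitAddCircle) 0).continuous.tendsto ((1 : ℝ) : ℂ)).comp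
      ((Complex.tendsto_ofReal_nhdsGT 1).mono_right nhdsWithin_le_nhds)
  have hright := (Complex.continuous_ofReal.tendsto _).comp
    (Real.tendsto_tsum_one_div_rpow_sub hx hx1)
  rw [← Complex.ofReal_one]
  refine tendsto_nhds_unique hleft (hright.congr' ?_)
  filter_upwards [self_mem_nhdsWithin] with s hs
  exact (HurwitzZeta.hurwitzZeta_sub_hurwitzZeta_zero_ofReal hx hx1 hs).symm

theorem tendsto_mul_riemannZeta_of_hasDerivAt {g : ℂ → ℂ} {g' : ℂ} (hg : HasDerivAt g g' 1)
    (h1 : g 1 = 0) : Tendsto (fun s => g s * riemannZeta s) (𝓝[≠] 1) (𝓝 g') := by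
  have h := (hasDerivAt_iff_tendsto_slope.1 hg).mul riemannZeta_residue_one
  rw [mul_one] at h
  refine h.congr' ?_
  filter_upwards [self_mem_nhdsWithin] with s hs
  have : s - 1 ≠ 0 := sub_ne_zero.2 hs
  rw [slope_def_field, h1, sub_zero]
  field_simp

theorem hasDerivAt_prod_one_sub_cpow_neg (a : ℕ) :
    HasDerivAt (fun s : ℂ => ∏ p ∈ a.primeFactors, (1 - (p : ℂ) ^ (-s)))
      ((∏ p ∈ a.primeFactors, (1 - (p : ℂ)⁻¹)) *
        ∑ p ∈ a.primeFactors, Complex.log p / ((p : ℂ) - 1)) 1 := by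
  have hp1 {p : ℕ} (hp : p ∈ a.primeFactors) : (p : ℂ) ≠ 0 ∧ (p : ℂ) - 1 ≠ 0 := by
    have h := Nat.prime_of_mem_primeFactors hp
    exact ⟨by exact_mod_cast h.ne_zero, sub_ne_zero.2 (by exact_mod_cast h.ne_one)⟩
  have hfac (p : ℕ) (hp : p ∈ a.primeFactors) :
      HasDerivAt (fun s : ℂ => 1 - (p : ℂ) ^ (-s)) ((p : ℂ)⁻¹ * Complex.log p) 1 := by
    have h := ((hasDerivAt_id (1 : ℂ)).neg.const_cpow (c := (p : ℂ)) (Or.inl (hp1 hp).1)).const_sub 1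
    simpa [Complex.cpow_neg_one] using! h
  refine (HasDerivAt.fun_finsetProd hfac).congr_deriv ?_
  rw [mul_sum]
  refine sum_congr rfl fun p hp => ?_
  obtain ⟨h0, h1⟩ := hp1 hp
  rw [← mul_prod_erase _ _ hp]
  simp only [smul_eq_mul, Complex.cpow_neg_one]
  field_simp

theorem average_of_L_one_over_nonprincipal_characters (a : ℕ) [NeZero a] (ha : 1 < a) :
    (1 / (a.totient : ℂ)) *
        ∑ χ ∈ Finset.univ.filter (fun χ : DirichletCharacter ℂ a => χ ≠ 1),
          (starRingEnd ℂ) (χ (-1)) * DirichletCharacter.LFunction χ 1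
      = -(1 / (a : ℂ)) *
          ((deriv Real.Gamma (((a : ℝ) - 1) / a) / Real.Gamma (((a : ℝ) - 1) / a)
              + ∑ p ∈ a.primeFactors, Real.log p / ((p : ℝ) - 1)
              + Real.log a + Real.eulerMascheroniConstant : ℝ) : ℂ) := by
  have ha0 : (a : ℂ) ≠ 0 := by exact_mod_cast (NeZero.ne a)
  have haR : (1 : ℝ) < a := by exact_mod_cast ha
  have hφ : (a.totient : ℂ) ≠ 0 := by exact_mod_cast (Nat.totient_pos.2 (by omega)).ne'
  set x : ℝ := ((a : ℝ) - 1) / a with hx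
  have hx0 : 0 < x := div_pos (by linarith) (by linarith)
  have hx1 : x ≤ 1 := (div_le_one (by linarith)).2 (by linarith)
  have hcircle : ZMod.toAddCircle (-1 : ZMod a) = (x : UnitAddCircle) := by
    have hx' : x = 1 + -((1 : ℕ) / a : ℝ) := by
      rw [hx]; push_cast; field_simp; ring
    have hone : ZMod.toAddCircle (1 : ZMod a) = (((1 : ℕ) / a : ℝ) : UnitAddCircle) := by
      rw [← ZMod.toAddCircle_natCast, Nat.cast_one]
    rw [map_neg, hone, hx', AddCircle.coe_add,
      AddCircle.coe_period, zero_add, AddCircle.coe_neg]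
  set P : ℂ → ℂ := fun s => ∏ p ∈ a.primeFactors, (1 - (p : ℂ) ^ (-s)) with hP
  set g : ℂ → ℂ := fun s => a.totient * (a : ℂ) ^ (-s) - P s with hg
  have hPtot : (a : ℂ) * ∏ p ∈ a.primeFactors, (1 - (p : ℂ)⁻¹) = a.totient := by
    have h := congrArg (fun q : ℚ => (q : ℂ)) (Nat.totient_eq_mul_prod_factors a)
    push_cast at h
    exact h.symm
  have hg1 : g 1 = 0 := by
    simp only [hg, hP, Complex.cpow_neg_one, ← hPtot]
    field_simp
    ring
  have hg' : HasDerivAt g (a.totient * ((a : ℂ)⁻¹ * -Complex.log a) -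
      (a.totient / a) * ∑ p ∈ a.primeFactors, Complex.log p / ((p : ℂ) - 1)) 1 := by
    have h := (hasDerivAt_id (1 : ℂ)).neg.const_cpow (c := (a : ℂ)) (Or.inl ha0)
    have h2 := (h.const_mul (a.totient : ℂ)).sub (hasDerivAt_prod_one_sub_cpow_neg a)
    rw [← hPtot, mul_div_cancel_left₀ _ ha0, hPtot]
    simpa [Complex.cpow_neg_one] using! h2
  set F : ℂ → ℂ := fun s => ∑ χ ∈ Finset.univ.filter (fun χ : DirichletCharacter ℂ a => χ ≠ 1),
    (starRingEnd ℂ) (χ (-1)) * DirichletCharacter.LFunction χ s with hF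
  set D : ℂ → ℂ := fun s => HurwitzZeta.hurwitzZeta (x : UnitAddCircle) s -
    HurwitzZeta.hurwitzZeta 0 s with hD
  have hFeq (s : ℂ) (hs : s ≠ 1) :
      a.totient * (a : ℂ) ^ (-s) * D s + g s * riemannZeta s = F s := by
    have h := DirichletCharacter.sum_conj_apply_neg_one_mul_LFunction a s
    rw [← Finset.sum_filter_add_sum_filter_not univ (fun χ : DirichletCharacter ℂ a => χ ≠ 1)] at h
    have htriv : (univ.filter fun χ : DirichletCharacter ℂ a => ¬ χ ≠ 1) = {1} := by
      ext χ; simp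
    have hone : (1 : DirichletCharacter ℂ a) (-1) = 1 := MulChar.one_apply isUnit_one.neg
    rw [htriv, sum_singleton, hone, map_one, one_mul, hcircle] at h
    have hL := DirichletCharacter.LFunctionTrivChar_eq_mul_riemannZeta (N := a) hs
    rw [DirichletCharacter.LFunctionTrivChar] at hL
    rw [hL] at h
    simp only [hD, hg, hP, hF, HurwitzZeta.hurwitzZeta_zero]
    linear_combination -h
  have hFcont : Continuous F := continuous_finsetSum _ fun χ hχ =>
    (DirichletCharacter.differentiable_LFunction (mem_filter.1 hχ).2).continuous.const_mul _
  have hDcont : Continuous D :=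
    (HurwitzZeta.differentiable_hurwitzZeta_sub_hurwitzZeta _ _).continuous
  have hpow : Continuous fun s : ℂ => (a.totient : ℂ) * (a : ℂ) ^ (-s) :=
    continuous_const.mul (continuous_neg.const_cpow (Or.inl ha0))
  have hlim := (((hpow.mul hDcont).tendsto 1).mono_left
    (nhdsWithin_le_nhds (s := {1}ᶜ))).add (tendsto_mul_riemannZeta_of_hasDerivAt hg' hg1)
  have hval := tendsto_nhds_unique ((hFcont.tendsto 1).mono_left nhdsWithin_le_nhds)
    (hlim.congr' (by filter_upwards [self_mem_nhdsWithin] with s hs using hFeq s hs))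
  have hD1 := HurwitzZeta.hurwitzZeta_one_sub_hurwitzZeta_zero_one hx0 hx1
  change (1 / (a.totient : ℂ)) * F 1 = _
  change D 1 = _ at hD1
  rw [hval, Pi.mul_apply, hD1, Complex.cpow_neg_one, logDeriv_apply]
  push_cast [Complex.natCast_log]
  field_simp
  ring
end
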